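/- Let N ≥ 3, α ∈ (0, N), and F continuous satisfying |F(s)| ≤ C(|s|^((N+α)/N) + |s|^((N+α)/(N-2))). Then there exist constants δ > 0 such that every u ∈ H¹(ℝᴺ) with ∫(|∇u|² + |u|²) ≤ δ satisfies ∫(I_α ∗ F(u)) F(u) ≤ ¼ ∫(|∇u|² + |u|²), and hence I(u) ≥ ¼ ∫(|∇u|² + |u|²). -/

import Mathlib

open MeasureTheory

section Sobolev
open scoped ENNReal NNReal
open Set Function Finset MeasureTheory Measure Filter

lemma diff_enorm_le_lintegral_Iic_deriv (f : ℝ → ℝ) (hf : Differentiable ℝ f)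
    (h2f : HasCompactSupport f) (b : ℝ) :
    ‖f b‖ₑ ≤ ∫⁻ y in Iic b, ‖deriv f y‖ₑ := by
  by_cases htop : ∫⁻ y in Iic b, ‖deriv f y‖ₑ = ⊤
  · rw [htop]; exact le_top
  obtain ⟨a, hab, ha⟩ : ∃ a ≤ b, f a = 0 := by
    have hb : Bornology.IsBounded (tsupport f) := h2f.isCompact.isBounded
    obtain ⟨R, hR⟩ := hb.subset_closedBall 0
    refine ⟨min b (-|R| - 1), min_le_left _ _, ?_⟩
    by_contra hne
    have := hR (subset_tsupport f hne)
    rw [mem_closedBall_zero_iff, Real.norm_eq_abs] at this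
    have h1 : min b (-|R| - 1) ≤ -|R| - 1 := min_le_right _ _
    have h2 := neg_abs_le (min b (-|R| - 1))
    have h3 := le_abs_self R
    linarith
  have hint : IntegrableOn (deriv f) (Iic b) :=
    ⟨(measurable_deriv f).aestronglyMeasurable, lt_top_iff_ne_top.2 htop⟩
  have hFTC : ∫ y in a..b, deriv f y = f b - f a :=
    intervalIntegral.integral_eq_sub_of_hasDerivAt (fun x _ => (hf x).hasDerivAt)
      ((intervalIntegrable_iff_integrableOn_Ioc_of_le hab).2
        (hint.mono_set Ioc_subset_Iic_self))
  rw [ha, sub_zero] at hFTC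
  rw [← hFTC, intervalIntegral.integral_of_le hab]
  exact (enorm_integral_le_lintegral_enorm _).trans
    (lintegral_mono_set Ioc_subset_Iic_self)

lemma differentiable_update {ι : Type*} [Fintype ι] [DecidableEq ι] (x : ι → ℝ) (i : ι) :
    Differentiable ℝ (update x i) :=
  fun y => (hasDerivAt_update x i y).differentiableAt

theorem diff_lintegral_pow_le_pow_lintegral_fderiv_aux {ι : Type*} [Fintype ι]
    {p : ℝ} (hp : Real.HolderConjugate (Fintype.card ι) p)
    {u : (ι → ℝ) → ℝ} (hu : Differentiable ℝ u)
    (h2u : HasCompactSupport u) :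
    ∫⁻ x, ‖u x‖ₑ ^ p ≤ (∫⁻ x, ‖fderiv ℝ u x‖ₑ) ^ p := by
  classical
  /- For a function `f` in one variable and `t ∈ ℝ` we have
  `|f(t)| = `|∫_{-∞}^t Df(s)∂s| ≤ ∫_ℝ |Df(s)| ∂s` where we use the fundamental theorem of calculus.
  For each `x ∈ ℝⁿ` we let `u` vary in one of the `n` coordinates and apply the inequality above.
  By taking the product over these `n` factors, raising them to the power `(n-1)⁻¹` and integrating,
  we get the inequality `∫ |u| ^ (n/(n-1)) ≤ ∫ x, ∏ i, (∫ xᵢ, |Du(update x i xᵢ)|)^(n-1)⁻¹`.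
  The result then follows from the grid-lines lemma. -/
  have : (1 : ℝ) ≤ ↑(Fintype.card ι) - 1 := by
    have hι : (2 : ℝ) ≤ (Fintype.card ι) := by exact_mod_cast hp.lt
    linarith
  calc ∫⁻ x, ‖u x‖ₑ ^ p
      = ∫⁻ x, (‖u x‖ₑ ^ (1 / ((Fintype.card ι) - 1 : ℝ))) ^ ((Fintype.card ι) : ℝ) := by
        -- a little algebraic manipulation of the exponent
        congr! 2 with x
        rw [← ENNReal.rpow_mul, hp.conjugate_eq]
        field_simp
    _ = ∫⁻ x, ∏ _i : ι, ‖u x‖ₑ ^ (1 / ((Fintype.card ι) - 1 : ℝ)) := by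
        -- express the left-hand integrand as a product of identical factors
        congr! 2 with x
        simp_rw [prod_const]
        norm_cast
    _ ≤ ∫⁻ x, ∏ i, (∫⁻ xᵢ, ‖fderiv ℝ u (update x i xᵢ)‖ₑ) ^ ((1 : ℝ) / ((Fintype.card ι) - 1 : ℝ)) := ?_
    _ ≤ (∫⁻ x, ‖fderiv ℝ u x‖ₑ) ^ p := by
        -- apply the grid-lines lemma
        apply lintegral_prod_lintegral_pow_le _ hp
        fun_prop
  -- we estimate |u x| using the fundamental theorem of calculus.
  gcongr with x i
  calc ‖u x‖ₑ
    _ ≤ ∫⁻ xᵢ in Iic (x i), ‖deriv (u ∘ update x i) xᵢ‖ₑ := by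
        have key := diff_enorm_le_lintegral_Iic_deriv (u ∘ update x i)
          (hu.comp (differentiable_update x i))
          (h2u.comp_isClosedEmbedding (isClosedEmbedding_update x i)) (x i)
        rwa [Function.comp_apply, update_eq_self] at key
    _ ≤ ∫⁻ xᵢ, ‖fderiv ℝ u (update x i xᵢ)‖ₑ := ?_
  gcongr with y
  · exact Measure.restrict_le_self
  -- bound the derivative which appears
  calc ‖deriv (u ∘ update x i) y‖ₑ = ‖fderiv ℝ u (update x i y) (deriv (update x i) y)‖ₑ := by
        rw [fderiv_comp_deriv _ hu.differentiableAt
          (hasDerivAt_update x i y).differentiableAt]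
    _ ≤ ‖fderiv ℝ u (update x i y)‖ₑ * ‖deriv (update x i) y‖ₑ := ContinuousLinearMap.le_opENorm _ _
    _ ≤ ‖fderiv ℝ u (update x i y)‖ₑ := by simp [deriv_update, Pi.enorm_single]


variable {E : Type*} [NormedAddCommGroup E] [NormedSpace ℝ E] [MeasurableSpace E] [BorelSpace E]
  [FiniteDimensional ℝ E] (μ : Measure E) [IsAddHaarMeasure μ]

open Module

theorem diff_lintegral_pow_le_pow_lintegral_fderiv {u : E → ℝ}
    (hu : Differentiable ℝ u) (h2u : HasCompactSupport u)
    {p : ℝ} (hp : Real.HolderConjugate (finrank ℝ E) p) :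
    ∫⁻ x, ‖u x‖ₑ ^ p ∂μ ≤
      lintegralPowLePowLIntegralFDerivConst μ p * (∫⁻ x, ‖fderiv ℝ u x‖ₑ ∂μ) ^ p := by
  /- We reduce to the case where `E` is `ℝⁿ`, for which we have already proved the result using
  an explicit basis in `MeasureTheory.diff_lintegral_pow_le_pow_lintegral_fderiv_aux`.
  This proof is not too hard, but takes quite some steps, reasoning about the equivalence
  `e : E ≃ ℝⁿ`, relating the measures on each sides of the equivalence,
  and estimating the derivative using the chain rule. -/
  set C := lintegralPowLePowLIntegralFDerivConst μ p
  let ι := Fin (finrank ℝ E)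
  have hιcard : (Fintype.card ι) = finrank ℝ E := Fintype.card_fin (finrank ℝ E)
  have : finrank ℝ E = finrank ℝ (ι → ℝ) := by simp [hιcard]
  let e : E ≃L[ℝ] ι → ℝ := ContinuousLinearEquiv.ofFinrankEq this
  have hp : Real.HolderConjugate (Fintype.card ι) p := by rwa [hιcard]
  have h0p : 0 ≤ p := hp.symm.nonneg
  let c := addHaarScalarFactor μ ((volume : Measure (ι → ℝ)).map e.symm)
  have hc : 0 < c := addHaarScalarFactor_pos_of_isAddHaarMeasure ..
  have h2c : μ = c • ((volume : Measure (ι → ℝ)).map e.symm) := isAddLeftInvariant_eq_smul ..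
  have h3c : (c : ℝ≥0∞) ≠ 0 := by simp_rw [ne_eq, ENNReal.coe_eq_zero, hc.ne', not_false_eq_true]
  have h0C : C = (c * ‖(e.symm : (ι → ℝ) →L[ℝ] E)‖₊ ^ p) * (c ^ p)⁻¹ := by
    simp_rw [c, ι, C, e, lintegralPowLePowLIntegralFDerivConst]
  have hC : C * c ^ p = c * ‖(e.symm : (ι → ℝ) →L[ℝ] E)‖₊ ^ p := by
    rw [h0C, inv_mul_cancel_right₀ (NNReal.rpow_pos hc).ne']
  simp only [h2c, ENNReal.smul_def, lintegral_smul_measure, smul_eq_mul]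
  let v : (ι → ℝ) → ℝ := u ∘ e.symm
  have hv : Differentiable ℝ v := hu.comp e.symm.differentiable
  have h2v : HasCompactSupport v := h2u.comp_homeomorph e.symm.toHomeomorph
  have :=
  calc ∫⁻ x, ‖u x‖ₑ ^ p ∂(volume : Measure (ι → ℝ)).map e.symm
      = ∫⁻ y, ‖v y‖ₑ ^ p := by
        refine lintegral_map ?_ e.symm.continuous.measurable
        exact hu.continuous.measurable.nnnorm.coe_nnreal_ennreal.pow_const _
    _ ≤ (∫⁻ y, ‖fderiv ℝ v y‖ₑ) ^ p := diff_lintegral_pow_le_pow_lintegral_fderiv_aux hp hv h2v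
    _ = (∫⁻ y, ‖(fderiv ℝ u (e.symm y)).comp (fderiv ℝ e.symm y)‖ₑ) ^ p := by
        congr! with y
        apply fderiv_comp _ (hu _)
        exact e.symm.differentiableAt
    _ ≤ (∫⁻ y, ‖fderiv ℝ u (e.symm y)‖ₑ * ‖(e.symm : (ι → ℝ) →L[ℝ] E)‖ₑ) ^ p := by
        gcongr with y
        rw [e.symm.fderiv]
        apply ContinuousLinearMap.opENorm_comp_le
    _ = (‖(e.symm : (ι → ℝ) →L[ℝ] E)‖ₑ * ∫⁻ y, ‖fderiv ℝ u (e.symm y)‖ₑ) ^ p := by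
        rw [lintegral_mul_const, mul_comm]
        fun_prop
    _ = (‖(e.symm : (ι → ℝ) →L[ℝ] E)‖₊ ^ p : ℝ≥0) * (∫⁻ y, ‖fderiv ℝ u (e.symm y)‖ₑ) ^ p := by
        rw [ENNReal.mul_rpow_of_nonneg _ _ h0p, enorm_eq_nnnorm, ← ENNReal.coe_rpow_of_nonneg _ h0p]
    _ = (‖(e.symm : (ι → ℝ) →L[ℝ] E)‖₊ ^ p : ℝ≥0)
        * (∫⁻ x, ‖fderiv ℝ u x‖ₑ ∂(volume : Measure (ι → ℝ)).map e.symm) ^ p := by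
        congr
        rw [lintegral_map _ e.symm.continuous.measurable]
        fun_prop
  rw [← ENNReal.mul_le_mul_iff_right h3c ENNReal.coe_ne_top, ← mul_assoc, ← ENNReal.coe_mul, ← hC,
    ENNReal.coe_mul] at this
  rw [ENNReal.mul_rpow_of_nonneg _ _ h0p, ← mul_assoc, ← ENNReal.coe_rpow_of_ne_zero hc.ne']
  exact this

theorem diff_eLpNorm_le_eLpNorm_fderiv_one {u : E → ℝ} (hu : Differentiable ℝ u) (h2u : HasCompactSupport u)
    {p : ℝ≥0} (hp : NNReal.HolderConjugate (finrank ℝ E) p) :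
    eLpNorm u p μ ≤ eLpNormLESNormFDerivOneConst μ p * eLpNorm (fderiv ℝ u) 1 μ := by
  have h0p : 0 < (p : ℝ) := hp.coe.symm.pos
  rw [eLpNorm_one_eq_lintegral_enorm,
    ← ENNReal.rpow_le_rpow_iff h0p, ENNReal.mul_rpow_of_nonneg _ _ h0p.le,
    ← ENNReal.coe_rpow_of_nonneg _ h0p.le, eLpNormLESNormFDerivOneConst, ← NNReal.rpow_mul,
    eLpNorm_nnreal_pow_eq_lintegral hp.symm.pos.ne',
    inv_mul_cancel₀ h0p.ne', NNReal.rpow_one]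
  exact diff_lintegral_pow_le_pow_lintegral_fderiv μ hu h2u hp.coe

theorem diff_eLpNorm_le_eLpNorm_fderiv_of_eq_inner {u : E → ℝ}
    (hu : Differentiable ℝ u) (h2u : HasCompactSupport u)
    {p p' : ℝ≥0} (hp : 1 ≤ p) (hn : 0 < finrank ℝ E)
    (hp' : (p' : ℝ)⁻¹ = p⁻¹ - (finrank ℝ E : ℝ)⁻¹) :
    eLpNorm u p' μ ≤ eLpNormLESNormFDerivOfEqInnerConst μ p * eLpNorm (fderiv ℝ u) p μ := by
  /- Here we derive the GNS-inequality for `p ≥ 1` from the version with `p = 1`.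
  For `p > 1` we apply the previous version to the function `|u|^γ` for a suitably chosen `γ`.
  The proof requires that `x ↦ |x|^p` is smooth in the codomain, so we require that it is a
  Hilbert space. -/
  by_cases hp'0 : p' = 0
  · simp [hp'0]
  set n := finrank ℝ E
  let n' := NNReal.conjExponent n
  have h2p : (p : ℝ) < n := by
    have : 0 < p⁻¹ - (n : ℝ)⁻¹ :=
      NNReal.coe_lt_coe.mpr (pos_iff_ne_zero.mpr (inv_ne_zero hp'0)) |>.trans_eq hp'
    rwa [NNReal.coe_inv, sub_pos,
      inv_lt_inv₀ _ (zero_lt_one.trans_le (NNReal.coe_le_coe.mpr hp))] at this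
    exact_mod_cast hn
  have h0n : 2 ≤ n := Nat.succ_le_of_lt <| Nat.one_lt_cast.mp <| hp.trans_lt h2p
  have hn : NNReal.HolderConjugate n n' := .conjExponent (by norm_cast)
  have h1n : 1 ≤ (n : ℝ≥0) := hn.lt.le
  have h2n : (0 : ℝ) < n - 1 := by simp_rw [sub_pos]; exact hn.coe.lt
  have hnp : (0 : ℝ) < n - p := by simp_rw [sub_pos]; exact h2p
  rcases hp.eq_or_lt with rfl | hp
  -- the case `p = 1`
  · convert! diff_eLpNorm_le_eLpNorm_fderiv_one μ hu h2u hn using 2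
    · suffices (p' : ℝ) = n' by simpa using this
      rw [← inv_inj, hp']
      simp [field, n', NNReal.conjExponent, *]
    · norm_cast
      simp_rw [n', n, eLpNormLESNormFDerivOfEqInnerConst]
      simp only [n, NNReal.coe_one] at hnp
      field_simp
      simp
  -- the case `p > 1`
  let q := Real.conjExponent p
  have hq : Real.HolderConjugate p q := .conjExponent hp
  have h0p : p ≠ 0 := zero_lt_one.trans hp |>.ne'
  have h1p : (p : ℝ) ≠ 1 := hq.lt.ne'
  have h3p : (p : ℝ) - 1 ≠ 0 := sub_ne_zero_of_ne h1p
  have h2q : 1 / n' - 1 / q = 1 / p' := by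
    simp_rw -zeta [one_div, hp']
    rw [← hq.one_sub_inv, ← hn.coe.one_sub_inv, sub_sub_sub_cancel_left]
    simp only [NNReal.coe_natCast, NNReal.coe_inv]
  let γ : ℝ≥0 := .mk (p * (n - 1) / (n - p)) (by positivity)
  have h0γ : (γ : ℝ) = p * (n - 1) / (n - p) := rfl
  have h1γ : 1 < (γ : ℝ) := by
    rwa [h0γ, one_lt_div hnp, mul_sub, mul_one, sub_lt_sub_iff_right, lt_mul_iff_one_lt_left]
    exact hn.coe.pos
  have h2γ : γ * n' = p' := by
    rw [← NNReal.coe_inj, ← inv_inj, hp', NNReal.coe_mul, h0γ, hn.coe.conjugate_eq]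
    simp [field]
  have h3γ : (γ - 1) * q = p' := by
    rw [← inv_inj, hp', h0γ, hq.conjugate_eq]
    have : (p : ℝ) * (n - 1) - (n - p) = n * (p - 1) := by ring
    simp [field, this]
  have h4γ : (γ : ℝ) ≠ 0 := (zero_lt_one.trans h1γ).ne'
  by_cases h3u : ∫⁻ x, ‖u x‖ₑ ^ (p' : ℝ) ∂μ = 0
  · rw [eLpNorm_nnreal_eq_lintegral hp'0, h3u, ENNReal.zero_rpow_of_pos] <;> positivity
  have h4u : ∫⁻ x, ‖u x‖ₑ ^ (p' : ℝ) ∂μ ≠ ∞ := by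
    refine lintegral_rpow_enorm_lt_top_of_eLpNorm'_lt_top
      ((NNReal.coe_pos.trans pos_iff_ne_zero).mpr hp'0) ?_ |>.ne
    rw [← eLpNorm_nnreal_eq_eLpNorm' hp'0]
    exact hu.continuous.memLp_of_hasCompactSupport (μ := μ) h2u |>.eLpNorm_lt_top
  have h5u : (∫⁻ x, ‖u x‖ₑ ^ (p' : ℝ) ∂μ) ^ (1 / q) ≠ 0 :=
    ENNReal.rpow_pos (pos_iff_ne_zero.mpr h3u) h4u |>.ne'
  have h6u : (∫⁻ x, ‖u x‖ₑ ^ (p' : ℝ) ∂μ) ^ (1 / q) ≠ ∞ := by finiteness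
  have h7u := hu.continuous -- for fun_prop
  let v : E → ℝ := fun x ↦ ‖u x‖ ^ (γ : ℝ)
  have hv : Differentiable ℝ v := hu.norm_rpow h1γ
  have h2v : HasCompactSupport v := h2u.norm.rpow_const h4γ
  set C := eLpNormLESNormFDerivOneConst μ n'
  have :=
  calc (∫⁻ x, ‖u x‖ₑ ^ (p' : ℝ) ∂μ) ^ (1 / (n' : ℝ)) = eLpNorm v n' μ := by
        rw [← h2γ, eLpNorm_nnreal_eq_lintegral hn.symm.pos.ne']
        simp (discharger := positivity) [v, Real.enorm_rpow_of_nonneg, ENNReal.rpow_mul]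
    _ ≤ C * eLpNorm (fderiv ℝ v) 1 μ := diff_eLpNorm_le_eLpNorm_fderiv_one μ hv h2v hn
    _ = C * ∫⁻ x, ‖fderiv ℝ v x‖ₑ ∂μ := by rw [eLpNorm_one_eq_lintegral_enorm]
    _ ≤ C * γ * ∫⁻ x, ‖u x‖ₑ ^ ((γ : ℝ) - 1) * ‖fderiv ℝ u x‖ₑ ∂μ := by
      rw [mul_assoc, ← lintegral_const_mul γ]
      · gcongr
        simp_rw [← mul_assoc]
        exact enorm_fderiv_norm_rpow_le (hu) h1γ
      dsimp [enorm]
      fun_prop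
    _ ≤ C * γ * ((∫⁻ x, ‖u x‖ₑ ^ (p' : ℝ) ∂μ) ^ (1 / q) *
        (∫⁻ x, ‖fderiv ℝ u x‖ₑ ^ (p : ℝ) ∂μ) ^ (1 / (p : ℝ))) := by
        gcongr
        convert!
          ENNReal.lintegral_mul_le_Lp_mul_Lq μ (.symm <| .conjExponent <| show 1 < (p : ℝ) from hp)
            ?_ ?_ using 5
        · simp [γ, n, q, ← ENNReal.rpow_mul, ← h3γ]
        · fun_prop
        · fun_prop
    _ = C * γ * (∫⁻ x, ‖fderiv ℝ u x‖ₑ ^ (p : ℝ) ∂μ) ^ (1 / (p : ℝ)) *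
      (∫⁻ x, ‖u x‖ₑ ^ (p' : ℝ) ∂μ) ^ (1 / q) := by ring
  calc
    eLpNorm u p' μ
      = (∫⁻ x, ‖u x‖ₑ ^ (p' : ℝ) ∂μ) ^ (1 / (p' : ℝ)) := eLpNorm_nnreal_eq_lintegral hp'0
    _ ≤ C * γ * (∫⁻ x, ‖fderiv ℝ u x‖ₑ ^ (p : ℝ) ∂μ) ^ (1 / (p : ℝ)) := by
      rwa [← h2q, ENNReal.rpow_sub _ _ h3u h4u, ENNReal.div_le_iff h5u h6u]
    _ = eLpNormLESNormFDerivOfEqInnerConst μ p * eLpNorm (fderiv ℝ u) (↑p) μ := by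
      suffices (C : ℝ) * γ = eLpNormLESNormFDerivOfEqInnerConst μ p by
        rw [eLpNorm_nnreal_eq_lintegral h0p]
        congr
        norm_cast at this ⊢
      simp_rw [eLpNormLESNormFDerivOfEqInnerConst, γ]
      refold_let n n' C
      rw [NNReal.coe_mul, NNReal.coe_mk, Real.coe_toNNReal', mul_eq_mul_left_iff, eq_comm,
        max_eq_left_iff]
      left
      positivity


lemma exists_cutoff (N : ℕ) :
    ∃ (χ : EuclideanSpace ℝ (Fin N) → ℝ) (K : ℝ≥0), Differentiable ℝ χ ∧ HasCompactSupport χ ∧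
      (∀ x, ‖fderiv ℝ χ x‖₊ ≤ K) ∧ (∀ x, ‖χ x‖ ≤ 1) ∧ (∀ x, ‖x‖ ≤ 1 → χ x = 1) := by
  let χ : ContDiffBump (0 : EuclideanSpace ℝ (Fin N)) := ⟨1, 2, by norm_num, by norm_num⟩
  have hχ : ContDiff ℝ 1 χ := χ.contDiff
  obtain ⟨K, hK⟩ := (χ.hasCompactSupport.fderiv (𝕜 := ℝ)).exists_bound_of_continuous
    (hχ.continuous_fderiv one_ne_zero)
  refine ⟨χ, K.toNNReal, hχ.differentiable one_ne_zero, χ.hasCompactSupport, fun x => ?_,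
    fun x => ?_, fun x hx => ?_⟩
  · rw [← NNReal.coe_le_coe, coe_nnnorm]
    exact (hK x).trans (Real.le_coe_toNNReal K)
  · rw [Real.norm_eq_abs, abs_of_nonneg χ.nonneg]; exact χ.le_one
  · exact χ.one_of_mem_closedBall (by rw [mem_closedBall_zero_iff]; exact hx)

set_option maxHeartbeats 1000000 in
lemma sobolev_diff (N : ℕ) (hN : 3 ≤ N) :
    ∃ S : ℝ≥0∞, S ≠ ⊤ ∧ ∀ u : EuclideanSpace ℝ (Fin N) → ℝ, Differentiable ℝ u →
      ∫⁻ x, ‖u x‖ₑ ^ (2 * (N : ℝ) / ((N : ℝ) - 2)) ≤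
        S * (∫⁻ x, (‖fderiv ℝ u x‖ₑ ^ (2 : ℝ) + ‖u x‖ₑ ^ (2 : ℝ))) ^ ((N : ℝ) / ((N : ℝ) - 2)) := by
  have hN' : (3 : ℝ) ≤ N := by exact_mod_cast hN
  have hN2 : (0 : ℝ) < (N : ℝ) - 2 := by linarith
  obtain ⟨χ, K, hχd, hχc, hK, hχ1, hχone⟩ := exists_cutoff N
  let p' : ℝ≥0 := (2 * (N : ℝ) / ((N : ℝ) - 2)).toNNReal
  have hp'c : (p' : ℝ) = 2 * (N : ℝ) / ((N : ℝ) - 2) := Real.coe_toNNReal _ (by positivity)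
  have hp'pos : 0 < (p' : ℝ) := by rw [hp'c]; positivity
  have hp'0 : p' ≠ 0 := fun h => by simp [h] at hp'pos
  obtain ⟨C, hcpt⟩ : ∃ C : ℝ≥0, ∀ v : EuclideanSpace ℝ (Fin N) → ℝ, Differentiable ℝ v → HasCompactSupport v →
      ∫⁻ x, ‖v x‖ₑ ^ (p' : ℝ) ≤
        (C * (∫⁻ x, ‖fderiv ℝ v x‖ₑ ^ (2 : ℝ)) ^ (1 / (2 : ℝ))) ^ (p' : ℝ) := by
    refine ⟨eLpNormLESNormFDerivOfEqInnerConst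
      (volume : Measure (EuclideanSpace ℝ (Fin N))) ((2 : ℝ≥0) : ℝ), fun v hv h2v => ?_⟩
    have h := diff_eLpNorm_le_eLpNorm_fderiv_of_eq_inner
      (volume : Measure (EuclideanSpace ℝ (Fin N))) hv h2v (p := 2) (p' := p')
      (by norm_num) (by simp; omega) (by
        rw [hp'c]; simp only [finrank_euclideanSpace, Fintype.card_fin]
        push_cast
        field_simp)
    rw [eLpNorm_nnreal_eq_lintegral hp'0, eLpNorm_nnreal_eq_lintegral two_ne_zero] at h
    have h' := ENNReal.rpow_le_rpow h hp'pos.le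
    rw [← ENNReal.rpow_mul, one_div_mul_cancel hp'pos.ne', ENNReal.rpow_one] at h'
    exact h'
  refine ⟨(C * (2 + 2 * (K : ℝ≥0∞) ^ (2 : ℝ)) ^ (1 / (2 : ℝ))) ^ (p' : ℝ), by finiteness, ?_⟩
  intro u hu
  set I := ∫⁻ x, (‖fderiv ℝ u x‖ₑ ^ (2 : ℝ) + ‖u x‖ₑ ^ (2 : ℝ)) with hI
  let v : ℕ → EuclideanSpace ℝ (Fin N) → ℝ := fun n x => χ (((n : ℝ) + 1)⁻¹ • x) * u x
  have hv : ∀ n, Differentiable ℝ (v n) := fun n =>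
    Differentiable.mul (hχd.comp (g := χ) (f := fun x => ((n : ℝ) + 1)⁻¹ • x) (by fun_prop)) hu
  have h2v : ∀ n, HasCompactSupport (v n) := fun n => by
    apply HasCompactSupport.mul_right
    exact hχc.comp_smul (by positivity)
  have hbd : ∀ n x, ‖fderiv ℝ (v n) x‖ ≤ ‖fderiv ℝ u x‖ + K * ‖u x‖ := by
    intro n x
    have hc : HasFDerivAt (fun x : EuclideanSpace ℝ (Fin N) => χ (((n : ℝ) + 1)⁻¹ • x))
        ((fderiv ℝ χ (((n : ℝ) + 1)⁻¹ • x)).comp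
          (((n : ℝ) + 1)⁻¹ • ContinuousLinearMap.id ℝ (EuclideanSpace ℝ (Fin N)))) x :=
      HasFDerivAt.comp (g := χ) x (hχd _).hasFDerivAt
        (((n : ℝ) + 1)⁻¹ • ContinuousLinearMap.id ℝ (EuclideanSpace ℝ (Fin N))).hasFDerivAt
    have hm := (hc.mul (hu x).hasFDerivAt).fderiv
    have hm' : fderiv ℝ (v n) x = _ := hm
    rw [hm']
    refine (norm_add_le _ _).trans ?_
    rw [norm_smul, norm_smul]
    have h1 : ‖χ (((n : ℝ) + 1)⁻¹ • x)‖ ≤ 1 := hχ1 _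
    have h2 : ‖(fderiv ℝ χ (((n : ℝ) + 1)⁻¹ • x)).comp
          (((n : ℝ) + 1)⁻¹ • ContinuousLinearMap.id ℝ (EuclideanSpace ℝ (Fin N)))‖ ≤ K := by
      rw [ContinuousLinearMap.comp_smul, ContinuousLinearMap.comp_id, norm_smul]
      have h3 : ‖((n : ℝ) + 1)⁻¹‖ ≤ 1 := by
        rw [norm_inv, Real.norm_eq_abs, abs_of_pos (by positivity)]
        apply inv_le_one_of_one_le₀
        have : (0 : ℝ) ≤ n := n.cast_nonneg
        linarith
      have h4 : ‖fderiv ℝ χ (((n : ℝ) + 1)⁻¹ • x)‖ ≤ K := by exact_mod_cast hK _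
      calc _ ≤ 1 * (K : ℝ) := by gcongr
        _ = K := one_mul _
    calc _ ≤ 1 * ‖fderiv ℝ u x‖ + ‖u x‖ * K := by gcongr
      _ = _ := by ring
  have hbd2 : ∀ n x, ‖fderiv ℝ (v n) x‖ₑ ^ (2 : ℝ) ≤ (2 + 2 * (K : ℝ≥0∞) ^ (2 : ℝ)) *
      (‖fderiv ℝ u x‖ₑ ^ (2 : ℝ) + ‖u x‖ₑ ^ (2 : ℝ)) := by
    intro n x
    have h : ‖fderiv ℝ (v n) x‖₊ ^ 2 ≤ (2 + 2 * K ^ 2) * (‖fderiv ℝ u x‖₊ ^ 2 + ‖u x‖₊ ^ 2) := by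
      rw [← NNReal.coe_le_coe]
      push_cast
      have h0 := hbd n x
      have h1 : ‖fderiv ℝ (v n) x‖ ^ 2 ≤ (‖fderiv ℝ u x‖ + K * ‖u x‖) ^ 2 := by gcongr
      nlinarith [sq_nonneg (‖fderiv ℝ u x‖ - K * ‖u x‖), sq_nonneg (‖u x‖),
        sq_nonneg (K * ‖fderiv ℝ u x‖)]
    simp only [enorm_eq_nnnorm]
    rw [ENNReal.rpow_two, ENNReal.rpow_two, ENNReal.rpow_two, ENNReal.rpow_two]
    exact_mod_cast h
  have hn : ∀ n, ∫⁻ x, ‖v n x‖ₑ ^ (p' : ℝ) ≤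
      (C * (2 + 2 * (K : ℝ≥0∞) ^ (2 : ℝ)) ^ (1 / (2 : ℝ))) ^ (p' : ℝ) *
        I ^ ((N : ℝ) / ((N : ℝ) - 2)) := by
    intro n
    refine (hcpt _ (hv n) (h2v n)).trans ?_
    have h1 : ∫⁻ x, ‖fderiv ℝ (v n) x‖ₑ ^ (2 : ℝ) ≤ (2 + 2 * (K : ℝ≥0∞) ^ (2 : ℝ)) * I := by
      rw [hI, ← lintegral_const_mul' _ _ (by finiteness)]
      exact lintegral_mono (hbd2 n)
    have h2 : I ^ ((N : ℝ) / ((N : ℝ) - 2)) = (I ^ (1 / (2 : ℝ))) ^ (p' : ℝ) := by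
      rw [← ENNReal.rpow_mul, hp'c]
      congr 1
      field_simp
    rw [h2, ← ENNReal.mul_rpow_of_nonneg _ _ hp'pos.le, mul_assoc,
      ← ENNReal.mul_rpow_of_nonneg _ _ (by norm_num)]
    gcongr
  have hlim : ∀ x, liminf (fun n => ‖v n x‖ₑ ^ (p' : ℝ)) atTop = ‖u x‖ₑ ^ (p' : ℝ) := by
    intro x
    apply Tendsto.liminf_eq
    apply tendsto_const_nhds.congr'
    filter_upwards [eventually_ge_atTop ⌈‖x‖⌉₊] with n hn
    have h1 : χ (((n : ℝ) + 1)⁻¹ • x) = 1 := by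
      apply hχone
      rw [norm_smul, norm_inv, Real.norm_eq_abs,
        abs_of_pos (by positivity), inv_mul_le_iff₀ (by positivity)]
      have := Nat.ceil_le.1 hn
      change ‖x‖ ≤ ((n : ℝ) + 1) * 1
      linarith
    simp only [v, h1, one_mul]
  calc ∫⁻ x, ‖u x‖ₑ ^ (2 * (N : ℝ) / ((N : ℝ) - 2))
      = ∫⁻ x, liminf (fun n => ‖v n x‖ₑ ^ (p' : ℝ)) atTop := by
        simp_rw [hlim, hp'c]
    _ ≤ liminf (fun n => ∫⁻ x, ‖v n x‖ₑ ^ (p' : ℝ)) atTop := by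
        apply lintegral_liminf_le
        intro n
        have := (hv n).continuous
        fun_prop
    _ ≤ _ := by
        refine liminf_le_of_le (by isBoundedDefault) ?_
        intro b hb
        obtain ⟨n, hb⟩ := hb.exists
        exact hb.trans (hn n)

end Sobolev

section HLS
open scoped ENNReal NNReal
open Set MeasureTheory Measure Filter

lemma hls_rpow_integrable (s : ℝ) (hs : 0 < s) (a : ℝ) :
    IntegrableOn (fun t : ℝ => t ^ (s - 1)) (Ioo 0 a) := by
  rcases le_or_gt a 0 with h | h
  · rw [Ioo_eq_empty (not_lt.2 h)]; exact integrableOn_empty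
  · exact ((intervalIntegrable_iff_integrableOn_Ioo_of_le h.le).1
      (intervalIntegral.intervalIntegrable_rpow' (by linarith)))

lemma hls_rpow_integral (s : ℝ) (hs : 0 < s) (a : ℝ) (ha : 0 ≤ a) :
    ∫ t in Ioo 0 a, t ^ (s - 1) = a ^ s / s := by
  rw [← integral_Ioc_eq_integral_Ioo, ← intervalIntegral.integral_of_le ha,
    integral_rpow (Or.inl (by linarith))]
  rw [sub_add_cancel, Real.zero_rpow hs.ne', sub_zero]

lemma hls_rpow_lintegral (s : ℝ) (hs : 0 < s) (a : ℝ) (ha : 0 ≤ a) :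
    ∫⁻ t in Ioo 0 a, ENNReal.ofReal (t ^ (s - 1)) = ENNReal.ofReal (a ^ s / s) := by
  rw [← hls_rpow_integral s hs a ha, ofReal_integral_eq_lintegral_ofReal
    (hls_rpow_integrable s hs a)]
  filter_upwards [ae_restrict_mem measurableSet_Ioo] with t ht
  exact Real.rpow_nonneg ht.1.le _

lemma hls_ball (N : ℕ) (hN : 3 ≤ N) (α : ℝ) (hα : 0 < α) :
    ∃ c : ℝ, 0 ≤ c ∧ ∀ r > 0, ∀ x : EuclideanSpace ℝ (Fin N),
      ∫⁻ y in Metric.ball x r, ENNReal.ofReal (‖x - y‖ ^ (α - (N : ℝ))) ≤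
        ENNReal.ofReal (c * r ^ α) := by
  have : Nontrivial (EuclideanSpace ℝ (Fin N)) := by
    apply Module.nontrivial_of_finrank_pos (R := ℝ)
    simp; omega
  refine ⟨N * (volume.real (Metric.ball (0 : EuclideanSpace ℝ (Fin N)) 1) * α⁻¹), by positivity,
    fun r hr x => ?_⟩
  set h : ℝ → ℝ := indicator (Iio r) (fun t => t ^ (α - (N : ℝ))) with hh
  have hpt : ∀ y ∈ Ioi (0 : ℝ), y ^ (N - 1) • h y = indicator (Iio r) (fun t => t ^ (α - 1)) y := by
    intro y hy
    by_cases hyr : y < r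
    · rw [hh, indicator_of_mem (show y ∈ Iio r from hyr),
        indicator_of_mem (show y ∈ Iio r from hyr), smul_eq_mul, ← Real.rpow_natCast,
        ← Real.rpow_add hy, Nat.cast_sub (by omega)]
      congr 1
      push_cast; ring
    · rw [hh, indicator_of_notMem (show y ∉ Iio r from hyr),
        indicator_of_notMem (show y ∉ Iio r from hyr), smul_zero]
  have hdim : Module.finrank ℝ (EuclideanSpace ℝ (Fin N)) = N := by simp
  have hint : Integrable (fun z : EuclideanSpace ℝ (Fin N) => h ‖z‖) volume := by
    rw [integrable_fun_norm_addHaar, hdim, integrableOn_congr_fun hpt measurableSet_Ioi,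
      integrableOn_indicator_iff measurableSet_Iio, inter_comm, Ioi_inter_Iio]
    exact hls_rpow_integrable α hα r
  have hval : ∫ z : EuclideanSpace ℝ (Fin N), h ‖z‖ =
      N * (volume.real (Metric.ball (0 : EuclideanSpace ℝ (Fin N)) 1) * α⁻¹) * r ^ α := by
    rw [integral_fun_norm_addHaar, hdim, setIntegral_congr_fun measurableSet_Ioi hpt,
      setIntegral_indicator measurableSet_Iio, Ioi_inter_Iio, hls_rpow_integral α hα r hr.le]
    simp only [nsmul_eq_mul, smul_eq_mul]
    ring
  have hnn : ∀ z : EuclideanSpace ℝ (Fin N), 0 ≤ h ‖z‖ := fun z =>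
    indicator_apply_nonneg (fun _ => Real.rpow_nonneg (norm_nonneg _) _)
  rw [← hval, ofReal_integral_eq_lintegral_ofReal hint (Eventually.of_forall hnn),
    ← lintegral_sub_left_eq_self (fun z => ENNReal.ofReal (h ‖z‖)) x, ← lintegral_indicator Metric.isOpen_ball.measurableSet]
  apply lintegral_mono
  intro y
  apply indicator_le
  intro y hy
  rw [Metric.mem_ball, dist_comm, dist_eq_norm] at hy
  rw [hh, indicator_of_mem (show ‖x - y‖ ∈ Iio r from hy)]

lemma hls_kernel (N : ℕ) (hN : 3 ≤ N) (α : ℝ) (hα : 0 < α) (hαN : α < N) :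
    ∃ K : ℝ≥0∞, K ≠ ⊤ ∧ ∀ (x : EuclideanSpace ℝ (Fin N)) (E : Set (EuclideanSpace ℝ (Fin N))),
      MeasurableSet E →
      ∫⁻ y in E, ENNReal.ofReal (‖x - y‖ ^ (α - (N : ℝ))) ≤ K * volume E ^ (α / N) := by
  obtain ⟨c, hc, hball⟩ := hls_ball N hN α hα
  have hN0 : (0 : ℝ) < N := by positivity
  refine ⟨ENNReal.ofReal (c + 1), by finiteness, fun x E hE => ?_⟩
  have hpos : 0 < α / N := by positivity
  rcases eq_or_ne (volume E) 0 with h0 | h0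
  · rw [setLIntegral_measure_zero _ _ h0]; exact zero_le
  rcases eq_or_ne (volume E) ⊤ with h1 | h1
  · rw [h1, ENNReal.top_rpow_of_pos hpos, ENNReal.mul_top]
    · exact le_top
    · simp; linarith
  set m := (volume E).toReal with hm
  have hm0 : 0 < m := ENNReal.toReal_pos h0 h1
  have hEm : volume E = ENNReal.ofReal m := (ENNReal.ofReal_toReal h1).symm
  set r := m ^ (1 / (N : ℝ)) with hr
  have hr0 : 0 < r := Real.rpow_pos_of_pos hm0 _
  have hrα : r ^ α = m ^ (α / N) := by
    rw [hr, ← Real.rpow_mul hm0.le]; congr 1; ring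
  have hfar : ∫⁻ y in E \ Metric.ball x r, ENNReal.ofReal (‖x - y‖ ^ (α - (N : ℝ))) ≤
      ENNReal.ofReal (m ^ (α / N)) := by
    calc _ ≤ ∫⁻ y in E \ Metric.ball x r, ENNReal.ofReal (r ^ (α - (N : ℝ))) := by
          apply setLIntegral_mono measurable_const
          intro y hy
          have hy2 : r ≤ ‖x - y‖ := by
            have := hy.2
            rw [Metric.mem_ball, dist_comm, dist_eq_norm, not_lt] at this
            exact this
          exact ENNReal.ofReal_le_ofReal
            (Real.rpow_le_rpow_of_nonpos hr0 hy2 (by linarith))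
      _ = ENNReal.ofReal (r ^ (α - (N : ℝ))) * volume (E \ Metric.ball x r) := by
          rw [setLIntegral_const]
      _ ≤ ENNReal.ofReal (r ^ (α - (N : ℝ))) * ENNReal.ofReal m := by
          rw [← hEm]; gcongr; exact sdiff_subset
      _ = ENNReal.ofReal (m ^ (α / N)) := by
          rw [← ENNReal.ofReal_mul (by positivity)]
          congr 1
          rw [hr, ← Real.rpow_mul hm0.le]
          nth_rewrite 2 [← Real.rpow_one m]
          rw [← Real.rpow_add hm0]
          congr 1
          field_simp
          ring
  calc _ ≤ ∫⁻ y in Metric.ball x r ∪ (E \ Metric.ball x r),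
          ENNReal.ofReal (‖x - y‖ ^ (α - (N : ℝ))) := by
        apply lintegral_mono_set
        rw [union_sdiff_self]; exact subset_union_right
    _ ≤ _ := lintegral_union_le _ _ _
    _ ≤ ENNReal.ofReal (c * r ^ α) + ENNReal.ofReal (m ^ (α / N)) := by
        gcongr; exact hball r hr0 x
    _ = _ := by
        rw [hEm, ENNReal.ofReal_rpow_of_pos hm0, hrα, ← ENNReal.ofReal_mul (by positivity),
          ← ENNReal.ofReal_add (by positivity) (by positivity)]
        congr 1; ring

lemma hls_inner (N : ℕ) (hN : 3 ≤ N) (α : ℝ) (hα : 0 < α) (hαN : α < N) :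
    ∃ K : ℝ≥0∞, K ≠ ⊤ ∧ ∀ f : EuclideanSpace ℝ (Fin N) → ℝ, Measurable f → (∀ x, 0 ≤ f x) →
      ∀ x, ∀ a > 0,
      ∫⁻ y, ENNReal.ofReal (min (f y) a) * ENNReal.ofReal (‖x - y‖ ^ (α - (N : ℝ))) ≤
        K * (∫⁻ y, ENNReal.ofReal (f y ^ (2 * N / (N + α)))) ^ (α / N) *
          ENNReal.ofReal (a ^ (2 * N / (N + α) - 1)) := by
  obtain ⟨K, hK, hker⟩ := hls_kernel N hN α hα hαN
  have hN0 : (0 : ℝ) < N := by positivity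
  set p : ℝ := 2 * N / (N + α) with hp
  have hp1 : 0 < p - 1 := by
    rw [hp, sub_pos, lt_div_iff₀ (by positivity)]; linarith
  have hpα : p * (α / N) = 1 - (p - 1) := by
    rw [hp]; field_simp; ring
  refine ⟨K * ENNReal.ofReal ((p - 1)⁻¹), by finiteness, fun f hf hf0 x a ha => ?_⟩
  set M := ∫⁻ y, ENNReal.ofReal (f y ^ p) with hM
  have hkm : Measurable (fun y : EuclideanSpace ℝ (Fin N) =>
      ENNReal.ofReal (‖x - y‖ ^ (α - (N : ℝ)))) := by fun_prop
  set ν := (volume : Measure (EuclideanSpace ℝ (Fin N))).withDensity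
    (fun y => ENNReal.ofReal (‖x - y‖ ^ (α - (N : ℝ)))) with hν
  have hαN0 : 0 ≤ α / N := by positivity
  have hcheb : ∀ t > 0, volume {y | t < f y} ≤ M * ENNReal.ofReal (t ^ (-p)) := by
    intro t ht
    have hpos : 0 < t ^ p := Real.rpow_pos_of_pos ht _
    have h := meas_ge_le_lintegral_div (μ := (volume : Measure (EuclideanSpace ℝ (Fin N))))
      (f := fun y => ENNReal.ofReal (f y ^ p)) (by fun_prop) (ε := ENNReal.ofReal (t ^ p))
      (by simpa using hpos) (by finiteness)
    rw [Real.rpow_neg ht.le, ENNReal.ofReal_inv_of_pos hpos, ← div_eq_mul_inv]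
    refine le_trans (measure_mono ?_) h
    intro y hy
    exact ENNReal.ofReal_le_ofReal (Real.rpow_le_rpow ht.le (le_of_lt hy) (by linarith))
  have hlevel : ∀ t ∈ Ioo 0 a, ν {y | t < min (f y) a} ≤
      K * M ^ (α / N) * ENNReal.ofReal (t ^ ((p - 1) - 1)) := by
    intro t ht
    have hms : MeasurableSet {y | t < f y} := measurableSet_lt measurable_const hf
    calc ν {y | t < min (f y) a} ≤ ν {y | t < f y} :=
          measure_mono fun y (hy : t < min (f y) a) => show t < f y from lt_of_lt_of_le hy (min_le_left _ _)
      _ = ∫⁻ y in {y | t < f y}, ENNReal.ofReal (‖x - y‖ ^ (α - (N : ℝ))) := by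
          rw [hν, withDensity_apply _ hms]
      _ ≤ K * volume {y | t < f y} ^ (α / N) := hker x _ hms
      _ ≤ K * (M * ENNReal.ofReal (t ^ (-p))) ^ (α / N) := by
          gcongr; exact hcheb t ht.1
      _ = _ := by
          rw [ENNReal.mul_rpow_of_nonneg _ _ hαN0,
            ENNReal.ofReal_rpow_of_nonneg (Real.rpow_nonneg ht.1.le _) hαN0,
            ← Real.rpow_mul ht.1.le, mul_assoc]
          congr 4
          rw [neg_mul, hpα]; ring
  calc ∫⁻ y, ENNReal.ofReal (min (f y) a) * ENNReal.ofReal (‖x - y‖ ^ (α - (N : ℝ)))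
      = ∫⁻ y, ENNReal.ofReal (min (f y) a) ∂ν := by
        rw [hν, lintegral_withDensity_eq_lintegral_mul _ hkm (by fun_prop)]
        simp only [Pi.mul_apply, mul_comm]
    _ = ∫⁻ t in Ioi 0, ν {y | t < min (f y) a} :=
        lintegral_eq_lintegral_meas_lt ν (Eventually.of_forall fun y => le_min (hf0 y) ha.le)
          (by fun_prop)
    _ ≤ ∫⁻ t in Ioi 0, (Ioo 0 a).indicator
          (fun t => K * M ^ (α / N) * ENNReal.ofReal (t ^ ((p - 1) - 1))) t := by
        apply setLIntegral_mono' measurableSet_Ioi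
        intro t ht
        by_cases hta : t < a
        · rw [indicator_of_mem (show t ∈ Ioo 0 a from ⟨ht, hta⟩)]
          exact hlevel t ⟨ht, hta⟩
        · have : {y | t < min (f y) a} = ∅ := by
            ext y
            simp only [mem_ofPred_eq, mem_empty_iff_false, iff_false, not_lt]
            exact (min_le_right _ _).trans (not_lt.1 hta)
          rw [this, measure_empty]; exact zero_le
    _ = ∫⁻ t in Ioo 0 a, K * M ^ (α / N) * ENNReal.ofReal (t ^ ((p - 1) - 1)) := by
        rw [setLIntegral_indicator measurableSet_Ioo,
          inter_eq_left.2 (Ioo_subset_Ioi_self)]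
    _ = K * M ^ (α / N) * ENNReal.ofReal (a ^ (p - 1) / (p - 1)) := by
        rw [lintegral_const_mul _ (by fun_prop), hls_rpow_lintegral _ hp1 a ha.le]
    _ = _ := by
        rw [div_eq_mul_inv (a ^ (p - 1)), ENNReal.ofReal_mul (by positivity)]
        ring

lemma hls_diag (N : ℕ) (hN : 3 ≤ N) (α : ℝ) (hα : 0 < α) (hαN : α < N) :
    ∃ K : ℝ≥0∞, K ≠ ⊤ ∧ ∀ f : EuclideanSpace ℝ (Fin N) → ℝ, Measurable f → (∀ x, 0 ≤ f x) →
      ∫⁻ x, ∫⁻ y, ENNReal.ofReal (f x) * (ENNReal.ofReal (f y) *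
          ENNReal.ofReal (‖x - y‖ ^ (α - (N : ℝ)))) ≤
        K * (∫⁻ y, ENNReal.ofReal (f y ^ (2 * N / (N + α)))) ^ (1 + α / N) := by
  obtain ⟨K, hK, hin⟩ := hls_inner N hN α hα hαN
  have hN0 : (0 : ℝ) < N := by positivity
  set p : ℝ := 2 * N / (N + α) with hp
  refine ⟨2 * K, by finiteness, fun f hf hf0 => ?_⟩
  set M := ∫⁻ y, ENNReal.ofReal (f y ^ p) with hM
  set G : EuclideanSpace ℝ (Fin N) → EuclideanSpace ℝ (Fin N) → ℝ≥0∞ := fun x y =>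
    ENNReal.ofReal (f x) * (ENNReal.ofReal (min (f y) (f x)) *
      ENNReal.ofReal (‖x - y‖ ^ (α - (N : ℝ)))) with hG
  have hGm : Measurable (Function.uncurry G) := by
    simp only [hG, Function.uncurry_def]
    fun_prop
  have hhalf : ∫⁻ x, ∫⁻ y, G x y ≤ K * M ^ (1 + α / N) := by
    calc ∫⁻ x, ∫⁻ y, G x y ≤ ∫⁻ x, K * M ^ (α / N) * ENNReal.ofReal (f x ^ p) := by
          apply lintegral_mono
          intro x
          dsimp only
          rw [hG, lintegral_const_mul' _ _ (by finiteness)]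
          rcases (hf0 x).eq_or_lt with h0 | h0
          · rw [← h0]; simp
          · calc _ ≤ ENNReal.ofReal (f x) * (K * M ^ (α / N) *
                    ENNReal.ofReal (f x ^ (p - 1))) := by
                  gcongr; exact hin f hf hf0 x (f x) h0
              _ = K * M ^ (α / N) * (ENNReal.ofReal (f x) * ENNReal.ofReal (f x ^ (p - 1))) := by
                  ring
              _ = _ := by
                  rw [← ENNReal.ofReal_mul (hf0 x)]
                  congr 2
                  nth_rewrite 1 [← Real.rpow_one (f x)]
                  rw [← Real.rpow_add h0]; congr 1; ring
      _ = K * M ^ (α / N) * M := by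
          rw [lintegral_const_mul _ (by fun_prop)]
      _ = K * M ^ (1 + α / N) := by
          rw [ENNReal.rpow_add_of_nonneg _ _ zero_le_one (by positivity), ENNReal.rpow_one]; ring
  have hswap : ∫⁻ x, ∫⁻ y, G y x = ∫⁻ x, ∫⁻ y, G x y :=
    (lintegral_lintegral_swap hGm.aemeasurable).symm
  calc _ ≤ ∫⁻ x, ∫⁻ y, (G x y + G y x) := by
        apply lintegral_mono; intro x
        apply lintegral_mono; intro y
        simp only [hG]
        rcases le_total (f y) (f x) with h | h
        · rw [min_eq_left h]; exact le_self_add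
        · rw [min_eq_left h, norm_sub_rev y x]
          refine le_trans (le_of_eq ?_) le_add_self
          ring
    _ = (∫⁻ x, ∫⁻ y, G x y) + ∫⁻ x, ∫⁻ y, G y x := by
        have hGl : Measurable fun x => ∫⁻ y, G x y := hGm.lintegral_prod_right'
        rw [← lintegral_add_left hGl]
        congr 1
        ext x
        rw [lintegral_add_left]
        exact hGm.of_uncurry_left
    _ ≤ K * M ^ (1 + α / N) + K * M ^ (1 + α / N) := by
        rw [hswap]; gcongr
    _ = _ := by ring

end HLS

lemma growth_pow (N α C a s : ℝ) (hN : 3 ≤ N) (hα : 0 < α) (hC : 0 < C) (ha : 0 ≤ a)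
    (hs : 0 ≤ s) (h : a ≤ C * (s ^ ((N + α) / N) + s ^ ((N + α) / (N - 2)))) :
    a ^ (2 * N / (N + α)) ≤ (2 * C) ^ (2 * N / (N + α)) *
      (s ^ (2 : ℝ) + s ^ (2 * N / (N - 2))) := by
  have hN2 : 0 < N - 2 := by linarith
  have hNa : 0 < N + α := by linarith
  have hN0 : 0 < N := by linarith
  have hp : 0 ≤ 2 * N / (N + α) := by positivity
  have e1 : (s ^ ((N + α) / N)) ^ (2 * N / (N + α)) = s ^ (2 : ℝ) := by
    rw [← Real.rpow_mul hs]; congr 1; field_simp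
  have e2 : (s ^ ((N + α) / (N - 2))) ^ (2 * N / (N + α)) = s ^ (2 * N / (N - 2)) := by
    rw [← Real.rpow_mul hs]; congr 1; field_simp
  rw [← e1, ← e2]
  set x := s ^ ((N + α) / N) with hx
  set y := s ^ ((N + α) / (N - 2)) with hy
  have hx0 : 0 ≤ x := Real.rpow_nonneg hs _
  have hy0 : 0 ≤ y := Real.rpow_nonneg hs _
  have hxp : 0 ≤ x ^ (2 * N / (N + α)) := Real.rpow_nonneg hx0 _
  have hyp : 0 ≤ y ^ (2 * N / (N + α)) := Real.rpow_nonneg hy0 _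
  rcases le_total x y with hxy | hxy
  · calc a ^ (2 * N / (N + α)) ≤ ((2 * C) * y) ^ (2 * N / (N + α)) :=
          Real.rpow_le_rpow ha (by nlinarith) hp
      _ = (2 * C) ^ (2 * N / (N + α)) * y ^ (2 * N / (N + α)) :=
          Real.mul_rpow (by positivity) hy0
      _ ≤ _ := by gcongr; linarith
  · calc a ^ (2 * N / (N + α)) ≤ ((2 * C) * x) ^ (2 * N / (N + α)) :=
          Real.rpow_le_rpow ha (by nlinarith) hp
      _ = (2 * C) ^ (2 * N / (N + α)) * x ^ (2 * N / (N + α)) :=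
          Real.mul_rpow (by positivity) hx0
      _ ≤ _ := by gcongr; linarith

/-- smallness of the nonlocal term and coercivity of the energy
near the origin of `H¹`. -/
theorem stmt3 (N : ℕ) (hN : 3 ≤ N) (α A : ℝ) (hα : 0 < α) (hαN : α < N) (hA : 0 < A)
    (C : ℝ) (hC : 0 < C) (F : ℝ → ℝ) (hFc : Continuous F)
    (hgrowth : ∀ s : ℝ, |F s| ≤ C * (|s| ^ (((N : ℝ) + α) / N) + |s| ^ (((N : ℝ) + α) / ((N : ℝ) - 2)))) :
    ∃ δ > (0 : ℝ), ∀ u : EuclideanSpace ℝ (Fin N) → ℝ,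
      Differentiable ℝ u →
      Integrable (fun x => ‖fderiv ℝ u x‖ ^ 2) (volume : Measure (EuclideanSpace ℝ (Fin N))) →
      Integrable (fun x => (u x) ^ 2) (volume : Measure (EuclideanSpace ℝ (Fin N))) →
      Integrable (fun x => (∫ y, A * ‖x - y‖ ^ (α - (N : ℝ)) * F (u y)) * F (u x))
        (volume : Measure (EuclideanSpace ℝ (Fin N))) →
      (∫ x, ‖fderiv ℝ u x‖ ^ 2 + (u x) ^ 2) ≤ δ →
      (∫ x, (∫ y, A * ‖x - y‖ ^ (α - (N : ℝ)) * F (u y)) * F (u x)) ≤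
          (1 / 4) * ∫ x, ‖fderiv ℝ u x‖ ^ 2 + (u x) ^ 2 ∧
      (1 / 4) * (∫ x, ‖fderiv ℝ u x‖ ^ 2 + (u x) ^ 2) ≤
        (1 / 2) * (∫ x, ‖fderiv ℝ u x‖ ^ 2 + (u x) ^ 2)
          - (1 / 2) * ∫ x, (∫ y, A * ‖x - y‖ ^ (α - (N : ℝ)) * F (u y)) * F (u x) := by
  obtain ⟨S, hS, hsob⟩ := sobolev_diff N hN
  obtain ⟨K, hK, hhls⟩ := hls_diag N hN α hα hαN
  have hN3 : (3 : ℝ) ≤ N := by exact_mod_cast hN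
  have hN0 : (0 : ℝ) < N := by linarith
  have hN2 : (0 : ℝ) < (N : ℝ) - 2 := by linarith
  set p : ℝ := 2 * N / (N + α) with hp
  set D : ENNReal := ENNReal.ofReal ((2 * C) ^ p) with hD
  have hθ : 0 < α / N := by positivity
  set Q' : ENNReal := ENNReal.ofReal A * (K * (D * (1 + S)) ^ (1 + α / N)) with hQ'
  have hQtop : Q' ≠ ⊤ := by finiteness
  set Q : ℝ := Q'.toReal with hQ
  have hQ0 : 0 ≤ Q := ENNReal.toReal_nonneg
  have hQQ : Q' = ENNReal.ofReal Q := (ENNReal.ofReal_toReal hQtop).symm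
  have hb : 0 < (4 * (Q + 1))⁻¹ := by positivity
  refine ⟨min 1 ((4 * (Q + 1))⁻¹ ^ (N / α)), by positivity, ?_⟩
  intro u hu hgrad hu2 _ hE
  set E := ∫ x, ‖fderiv ℝ u x‖ ^ 2 + (u x) ^ 2 with hEdef
  have hE0 : 0 ≤ E := integral_nonneg fun x => by positivity
  have hE1 : E ≤ 1 := hE.trans (min_le_left _ _)
  have hEθ : E ^ (α / N) ≤ (4 * (Q + 1))⁻¹ := by
    calc E ^ (α / N) ≤ ((4 * (Q + 1))⁻¹ ^ (N / α)) ^ (α / N) :=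
          Real.rpow_le_rpow hE0 (hE.trans (min_le_right _ _)) hθ.le
      _ = (4 * (Q + 1))⁻¹ := by
          rw [← Real.rpow_mul hb.le]
          have : (N : ℝ) / α * (α / N) = 1 := by field_simp
          rw [this, Real.rpow_one]
  have hsq : ∀ r : ℝ, ENNReal.ofReal (r ^ 2) = ‖r‖ₑ ^ (2 : ℝ) := fun r => by
    rw [ENNReal.rpow_two, ← sq_abs, ENNReal.ofReal_pow (abs_nonneg r), ← Real.norm_eq_abs,
      ofReal_norm]
  have hI : ∫⁻ x, (‖fderiv ℝ u x‖ₑ ^ (2 : ℝ) + ‖u x‖ₑ ^ (2 : ℝ)) = ENNReal.ofReal E := by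
    have hint : Integrable (fun x => ‖fderiv ℝ u x‖ ^ 2 + (u x) ^ 2)
        (volume : Measure (EuclideanSpace ℝ (Fin N))) := hgrad.add hu2
    rw [hEdef, ofReal_integral_eq_lintegral_ofReal hint
      (Filter.Eventually.of_forall fun x => add_nonneg (sq_nonneg _) (sq_nonneg _))]
    congr 1
    ext x
    rw [ENNReal.ofReal_add (by positivity) (by positivity), hsq, hsq, enorm_norm]
  have hcont : Continuous u := hu.continuous
  have hFu : Continuous fun x => F (u x) := hFc.comp hcont
  -- the Lebesgue norm of the nonlinearity
  have hM : ∫⁻ x, ENNReal.ofReal (|F (u x)| ^ p) ≤ D * (1 + S) * ENNReal.ofReal E := by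
    have hq0 : 0 ≤ 2 * (N : ℝ) / ((N : ℝ) - 2) := by positivity
    calc ∫⁻ x, ENNReal.ofReal (|F (u x)| ^ p)
        ≤ ∫⁻ x, D * (‖u x‖ₑ ^ (2 : ℝ) + ‖u x‖ₑ ^ (2 * (N : ℝ) / ((N : ℝ) - 2))) := by
          apply lintegral_mono
          intro x
          have h := ENNReal.ofReal_le_ofReal (growth_pow N α C _ _ hN3 hα hC (abs_nonneg _)
            (abs_nonneg _) (hgrowth (u x)))
          rw [ENNReal.ofReal_mul (by positivity), ENNReal.ofReal_add (by positivity)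
            (by positivity), ← ENNReal.ofReal_rpow_of_nonneg (abs_nonneg _) zero_le_two,
            ← ENNReal.ofReal_rpow_of_nonneg (abs_nonneg _) hq0, ← Real.norm_eq_abs (u x),
            ofReal_norm] at h
          exact h
      _ = D * ((∫⁻ x, ‖u x‖ₑ ^ (2 : ℝ)) +
            ∫⁻ x, ‖u x‖ₑ ^ (2 * (N : ℝ) / ((N : ℝ) - 2))) := by
          rw [lintegral_const_mul' _ _ (by finiteness), lintegral_add_left (by fun_prop)]
      _ ≤ D * (ENNReal.ofReal E + S * ENNReal.ofReal E) := by
          gcongr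
          · rw [← hI]; exact lintegral_mono fun x => le_add_self
          · refine (hsob u hu).trans ?_
            rw [hI]
            gcongr
            calc ENNReal.ofReal E ^ ((N : ℝ) / ((N : ℝ) - 2)) ≤ ENNReal.ofReal E ^ (1 : ℝ) := by
                  apply ENNReal.rpow_le_rpow_of_exponent_ge
                  · simpa using hE1
                  · rw [le_div_iff₀ hN2]; linarith
              _ = _ := ENNReal.rpow_one _
      _ = _ := by ring
  have hdouble : ‖∫ x, (∫ y, A * ‖x - y‖ ^ (α - (N : ℝ)) * F (u y)) * F (u x)‖ₑ ≤
      ENNReal.ofReal (Q * E ^ (1 + α / N)) := by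
    calc _ ≤ ∫⁻ x, ‖(∫ y, A * ‖x - y‖ ^ (α - (N : ℝ)) * F (u y)) * F (u x)‖ₑ :=
          enorm_integral_le_lintegral_enorm _
      _ ≤ ∫⁻ x, ENNReal.ofReal A * ∫⁻ y, ENNReal.ofReal |F (u x)| * (ENNReal.ofReal |F (u y)| *
            ENNReal.ofReal (‖x - y‖ ^ (α - (N : ℝ)))) := by
          apply lintegral_mono
          intro x
          dsimp only
          rw [enorm_mul, lintegral_const_mul' _ _ (by finiteness),
            ← Real.norm_eq_abs (F (u x)), ofReal_norm, mul_left_comm, mul_comm _ ‖F (u x)‖ₑ]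
          gcongr
          refine (enorm_integral_le_lintegral_enorm _).trans ?_
          rw [← lintegral_const_mul' _ _ (by finiteness)]
          apply lintegral_mono
          intro y
          dsimp only
          rw [enorm_mul, enorm_mul, Real.enorm_of_nonneg hA.le,
            Real.enorm_of_nonneg (Real.rpow_nonneg (norm_nonneg _) _),
            ← Real.norm_eq_abs (F (u y)), ofReal_norm]
          exact le_of_eq (by ring)
      _ = ENNReal.ofReal A * ∫⁻ x, ∫⁻ y, ENNReal.ofReal |F (u x)| * (ENNReal.ofReal |F (u y)| *
            ENNReal.ofReal (‖x - y‖ ^ (α - (N : ℝ)))) :=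
          lintegral_const_mul' _ _ (by finiteness)
      _ ≤ ENNReal.ofReal A * (K * (D * (1 + S) * ENNReal.ofReal E) ^ (1 + α / N)) := by
          gcongr
          refine (hhls (fun x => |F (u x)|) hFu.abs.measurable fun x => abs_nonneg _).trans ?_
          gcongr
      _ = Q' * ENNReal.ofReal E ^ (1 + α / N) := by
          rw [ENNReal.mul_rpow_of_nonneg _ _ (by positivity), hQ']
          ring
      _ = _ := by
          rw [hQQ, ENNReal.ofReal_rpow_of_nonneg hE0 (by positivity),
            ← ENNReal.ofReal_mul hQ0]
  have hreal : (∫ x, (∫ y, A * ‖x - y‖ ^ (α - (N : ℝ)) * F (u y)) * F (u x)) ≤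
      Q * E ^ (1 + α / N) := by
    rw [← ofReal_norm, ENNReal.ofReal_le_ofReal_iff (by positivity)] at hdouble
    exact (Real.le_norm_self _).trans hdouble
  have hfin : Q * E ^ (1 + α / N) ≤ (1 / 4) * E := by
    rw [Real.rpow_add_of_nonneg hE0 zero_le_one hθ.le, Real.rpow_one]
    calc Q * (E * E ^ (α / N)) ≤ Q * (E * (4 * (Q + 1))⁻¹) := by gcongr
      _ = (Q / (Q + 1)) * (1 / 4 * E) := by field_simp
      _ ≤ 1 * (1 / 4 * E) := by
          gcongr
          rw [div_le_one (by positivity)]; linarith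
      _ = _ := one_mul _
  have h1 := hreal.trans hfin
  exact ⟨h1, by linarith⟩
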